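/- (John–Nirenberg inequality, dyadic form.) Let I be a dyadic interval and let f ∈ S₀(I) be real-valued. Then ‖f‖_{L^p} ≤ C(1+p)|I|^{1/p}‖f‖_{BMO} for all 0 < p < ∞ (with an absolute constant C), and moreover |{x ∈ I : f(x) > 2n‖f‖_{BMO}}| ≤ 2^{−n+1}|I| for every positive integer n. -/

import Mathlib

open MeasureTheory Set

noncomputable section

namespace Dyadic

/-- A dyadic interval/lacunary tile: `I = [j·2^k, (j+1)·2^k)` with `-M ≤ k ≤ M`,
`I ⊆ [0, 2^M)`.  Lacunary tiles are in bijection with dyadic intervals, so we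
identify the tile `P⁺(I) = I × [1/|I|, 2/|I|)` with the data of `I`. -/
structure Tile (M : ℕ) where
  j : ℤ
  k : ℤ
  hk_lb : -(M : ℤ) ≤ k
  hk_ub : k ≤ (M : ℤ)
  hj : 0 ≤ j
  hsub : ((j : ℝ) + 1) * 2 ^ k ≤ 2 ^ (M : ℤ)

variable {M : ℕ}

/-- The side length `|I_P| = 2^k` of the spatial interval of the tile. -/
def Tile.len (P : Tile M) : ℝ := 2 ^ P.k

/-- The spatial interval `I_P` of the tile. -/
def Tile.ival (P : Tile M) : Set ℝ :=
  Ico ((P.j : ℝ) * 2 ^ P.k) (((P.j : ℝ) + 1) * 2 ^ P.k)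

/-- The order `P ≤′ Q` on lacunary tiles: `I_P ⊆ I_Q`. -/
def Tile.le (P Q : Tile M) : Prop := P.ival ⊆ Q.ival

/-- A (lacunary) tree: a collection of tiles together with a top tile. -/
structure Tree (M : ℕ) where
  tiles : Set (Tile M)
  top : Tile M
  top_mem : top ∈ tiles
  le_top : ∀ P ∈ tiles, P.le top

/-- `|I_T|`, the length of the spatial interval of the top of the tree. -/
def Tree.len (T : Tree M) : ℝ := T.top.len

/-- A collection of tiles is convex if `P₁ ≤′ P ≤′ P₂` with `P₁, P₂` in the
collection implies `P` is in the collection. -/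
def IsConvex (PP : Set (Tile M)) : Prop :=
  ∀ P₁ ∈ PP, ∀ P₂ ∈ PP, ∀ P : Tile M, P₁.le P → P.le P₂ → P ∈ PP

/-- The size `‖a‖_{size(T)} = (1/|I_T|) Σ_{P ∈ T} a(P)` of `a` on a tree `T`. -/
def treeSize (a : Tile M → ℝ) (T : Tree M) : ℝ :=
  (∑ᶠ P ∈ T.tiles, a P) / T.len

/-- The maximal size `‖a‖_{size*(PP)}`: the supremum of `‖a‖_{size(T)}` over all
convex trees `T ⊆ PP` (by convention `0` if there are none). -/
def maxSize (a : Tile M → ℝ) (PP : Set (Tile M)) : ℝ :=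
  sSup (insert 0 {s : ℝ | ∃ T : Tree M, T.tiles ⊆ PP ∧ IsConvex T.tiles ∧ s = treeSize a T})

/-- The complete tree `Tree(P) = {Q : Q ≤′ P}`. -/
def cTree (P : Tile M) : Set (Tile M) := {Q : Tile M | Q.le P}

/-- A tree `T` is complete with respect to `PP` if `T = Tree(P_T) ∩ PP`. -/
def Tree.IsCompleteIn (T : Tree M) (PP : Set (Tile M)) : Prop :=
  T.tiles = cTree T.top ∩ PP

/-- `QQ` is an `α`-packing of the tree `T`: `QQ ⊆ T` and `Σ_{P ∈ QQ} |I_P| ≤ α|I_T|`. -/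
def IsPacking (α : ℝ) (QQ : Set (Tile M)) (T : Tree M) : Prop :=
  QQ ⊆ T.tiles ∧ (∑ᶠ P ∈ QQ, Tile.len P) ≤ α * T.len

/-- `QQ` is a uniform `α`-packing of the tree `T`:
`Σ_{P ∈ QQ, I_P ⊆ J} |I_P| ≤ α|J|` for every dyadic interval `J`. -/
def IsUniformPacking (α : ℝ) (QQ : Set (Tile M)) (T : Tree M) : Prop :=
  QQ ⊆ T.tiles ∧
    ∀ J : Tile M, (∑ᶠ P ∈ {P ∈ QQ | P.ival ⊆ J.ival}, Tile.len P) ≤ α * J.len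

/-- Left half of the spatial interval. -/
def Tile.left (P : Tile M) : Set ℝ :=
  Ico ((P.j : ℝ) * 2 ^ P.k) (((P.j : ℝ) + 1 / 2) * 2 ^ P.k)

/-- Right half of the spatial interval. -/
def Tile.right (P : Tile M) : Set ℝ :=
  Ico (((P.j : ℝ) + 1 / 2) * 2 ^ P.k) (((P.j : ℝ) + 1) * 2 ^ P.k)

/-- The (mother) Haar wavelet `φ_P = |I_P|^{-1/2}(χ_{I_l} - χ_{I_r})`. -/
def Tile.haar (P : Tile M) : ℝ → ℝ := fun x =>
  (Real.sqrt P.len)⁻¹ * (P.left.indicator 1 x - P.right.indicator 1 x)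

/-- The Haar (wavelet) coefficient `Wf(P) = ⟨f, φ_P⟩`. -/
def waveCoeff (f : ℝ → ℝ) (P : Tile M) : ℝ := ∫ x, f x * P.haar x

/-- The average `[f]_{I_P} = (1/|I_P|)∫_{I_P} f`. -/
def tileAvg (f : ℝ → ℝ) (P : Tile M) : ℝ := (∫ x in P.ival, f x) / P.len

/-- The mean `‖f‖_{mean(P)} = (1/|I_P|)∫_{I_P} |f|`. -/
def tileMean (f : ℝ → ℝ) (P : Tile M) : ℝ := (∫ x in P.ival, |f x|) / P.len

/-- The maximal mean `‖f‖_{mean*(PP)} = sup_{P ∈ PP} ‖f‖_{mean(P)}`. -/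
def maxMean (f : ℝ → ℝ) (PP : Set (Tile M)) : ℝ :=
  sSup (insert 0 (tileMean f '' PP))

/-- The dyadic BMO norm `‖f‖_{BMO} = ‖|Wf|²‖_{size*(PP⁺)}^{1/2}`. -/
def bmoNorm (M : ℕ) (f : ℝ → ℝ) : ℝ :=
  Real.sqrt (maxSize (fun P : Tile M => waveCoeff f P ^ 2) univ)

/-- The grid interval `[j·2^{-M}, (j+1)·2^{-M})` at the finest scale. -/
def gridIval (M : ℕ) (j : ℤ) : Set ℝ :=
  Ico ((j : ℝ) * 2 ^ (-(M : ℤ))) (((j : ℝ) + 1) * 2 ^ (-(M : ℤ)))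

/-- A dyadic test function: supported on `[0, 2^M)` and constant on every dyadic
interval of length `2^{-M}`. -/
def IsTestFun (M : ℕ) (f : ℝ → ℝ) : Prop :=
  (∀ x : ℝ, x ∉ Ico (0 : ℝ) (2 ^ (M : ℤ)) → f x = 0) ∧
    ∀ j : ℤ, ∀ x ∈ gridIval M j, ∀ y ∈ gridIval M j, f x = f y

/-- The `L²` norm. -/
def l2Norm (f : ℝ → ℝ) : ℝ := Real.sqrt (∫ x, f x ^ 2)

/-- The `L^∞` norm (as a supremum of values; adequate for test functions). -/
def supNorm (f : ℝ → ℝ) : ℝ := ⨆ x : ℝ, |f x|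

/-- The weak `L^r` quasinorm `sup_{λ>0} λ |{|h| ≥ λ}|^{1/r}`. -/
def weakNorm (r : ℝ) (h : ℝ → ℝ) : ℝ :=
  sSup {s : ℝ | ∃ l : ℝ, 0 < l ∧ s = l * (volume {x : ℝ | l ≤ |h x|}).toReal ^ (1 / r)}

/-- The phase space projection `Π_T f = Σ_{P ∈ T} ⟨f, φ_P⟩ φ_P` onto a tree. -/
def treeProj (T : Tree M) (f : ℝ → ℝ) : ℝ → ℝ := fun x =>
  ∑ᶠ P ∈ T.tiles, waveCoeff f P * P.haar x

/-- The high-low paraproduct `π_hl(f,g) = Σ_P Wf(P) [g]_P φ_P`. -/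
def paraHL (M : ℕ) (f g : ℝ → ℝ) : ℝ → ℝ := fun x =>
  ∑ᶠ P : Tile M, waveCoeff f P * tileAvg g P * P.haar x

/-- The low-high paraproduct `π_lh(f,g) = Σ_P [f]_P Wg(P) φ_P`. -/
def paraLH (M : ℕ) (f g : ℝ → ℝ) : ℝ → ℝ := fun x =>
  ∑ᶠ P : Tile M, tileAvg f P * waveCoeff g P * P.haar x

/-- The high-high paraproduct `π_hh(f,g) = Σ_P Wf(P) Wg(P) χ_{I_P}/|I_P|`. -/
def paraHH (M : ℕ) (f g : ℝ → ℝ) : ℝ → ℝ := fun x =>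
  ∑ᶠ P : Tile M, waveCoeff f P * waveCoeff g P * P.ival.indicator 1 x / P.len

/-- The constant function `1` on `[0, 2^M)`. -/
def oneFn (M : ℕ) : ℝ → ℝ := (Ico (0 : ℝ) (2 ^ (M : ℤ))).indicator 1

/-- A perfect dyadic Calderón–Zygmund operator, recorded via its kernel `K` and
kernel constant `A₀`. -/
structure PDCZ (M : ℕ) where
  K : ℝ → ℝ → ℝ
  A₀ : ℝ
  hA₀ : 0 < A₀
  meas : Measurable (Function.uncurry K)
  bound : ∀ x y : ℝ, x ≠ y → |K x y| ≤ A₀ / |x - y|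
  perfectX : ∀ I J : Tile M, Disjoint I.ival J.ival →
    ∀ x ∈ I.ival, ∀ x' ∈ I.ival, ∀ y ∈ J.ival, K x y = K x' y
  perfectY : ∀ I J : Tile M, Disjoint I.ival J.ival →
    ∀ x ∈ I.ival, ∀ x' ∈ I.ival, ∀ y ∈ J.ival, K y x = K y x'
  diag : ∀ I : Tile M, I.k = -(M : ℤ) → ∀ x ∈ I.ival, ∀ y ∈ I.ival, K x y = 0
  corner₁ : ∀ x ∈ Ico (0 : ℝ) (2 ^ ((M : ℤ) - 1)),
    ∀ y ∈ Ico ((2 : ℝ) ^ ((M : ℤ) - 1)) (2 ^ (M : ℤ)), K x y = 0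
  corner₂ : ∀ x ∈ Ico ((2 : ℝ) ^ ((M : ℤ) - 1)) (2 ^ (M : ℤ)),
    ∀ y ∈ Ico (0 : ℝ) (2 ^ ((M : ℤ) - 1)), K x y = 0

/-- `Tf(x) = ∫ K(x,y) f(y) dy`. -/
def PDCZ.app (Op : PDCZ M) (f : ℝ → ℝ) : ℝ → ℝ := fun x => ∫ y, Op.K x y * f y

/-- The transpose `T*f(x) = ∫ K(y,x) f(y) dy`. -/
def PDCZ.appT (Op : PDCZ M) (f : ℝ → ℝ) : ℝ → ℝ := fun x => ∫ y, Op.K y x * f y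

/-- Complex-valued Haar coefficient. -/
def waveCoeffC (b : ℝ → ℂ) (P : Tile M) : ℂ := ∫ x, b x * (P.haar x : ℂ)

/-- Complex-valued average. -/
def tileAvgC (b : ℝ → ℂ) (P : Tile M) : ℂ := (∫ x in P.ival, b x) / (P.len : ℂ)

/-- BMO norm of a complex-valued function. -/
def bmoNormC (M : ℕ) (b : ℝ → ℂ) : ℝ :=
  Real.sqrt (maxSize (fun P : Tile M => ‖waveCoeffC b P‖ ^ 2) univ)

/-- Complex-valued dyadic test functions. -/
def IsTestFunC (M : ℕ) (b : ℝ → ℂ) : Prop :=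
  (∀ x : ℝ, x ∉ Ico (0 : ℝ) (2 ^ (M : ℤ)) → b x = 0) ∧
    ∀ j : ℤ, ∀ x ∈ gridIval M j, ∀ y ∈ gridIval M j, b x = b y

/-- The operator applied to a complex-valued function. -/
def PDCZ.appC (Op : PDCZ M) (b : ℝ → ℂ) : ℝ → ℂ := fun x => ∫ y, (Op.K x y : ℂ) * b y


lemma bell_ineq (c a b v : ℝ) (ha : 0 ≤ a) (hb : 0 ≤ b) (hv : v ≤ 1/8)
    (h : c^2 + (a+b)/2 ≤ v) :
    (Real.exp c * (1+3*a-2*a^2) + Real.exp (-c) * (1+3*b-2*b^2))/2 ≤ 1+3*v-2*v^2 := by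
  have hc2 : c^2 ≤ 1/8 := by nlinarith
  have hc : |c| ≤ 1 := by
    apply abs_le_one_iff_mul_self_le_one.2; nlinarith
  have e1 := (abs_le.1 (Real.abs_exp_sub_one_sub_id_le hc)).2
  have e2 := (abs_le.1 (Real.abs_exp_sub_one_sub_id_le (x := -c) (by rwa [abs_neg]))).2
  have ga : 0 ≤ 1+3*a-2*a^2 := by nlinarith [sq_nonneg c]
  have gb : 0 ≤ 1+3*b-2*b^2 := by nlinarith [sq_nonneg c]
  have k1 : Real.exp c * (1+3*a-2*a^2) ≤ (1+c+c^2) * (1+3*a-2*a^2) :=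
    mul_le_mul_of_nonneg_right (by linarith) ga
  have k2 : Real.exp (-c) * (1+3*b-2*b^2) ≤ (1-c+c^2) * (1+3*b-2*b^2) :=
    mul_le_mul_of_nonneg_right (by nlinarith) gb
  have mono : 1+3*(c^2+(a+b)/2)-2*(c^2+(a+b)/2)^2 ≤ 1+3*v-2*v^2 := by
    nlinarith [sq_nonneg c]
  refine le_trans ?_ mono
  obtain ⟨m, hm⟩ : ∃ m, m = (a+b)/2 := ⟨_, rfl⟩
  obtain ⟨d, hd⟩ : ∃ d, d = (a-b)/2 := ⟨_, rfl⟩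
  have ea : a = m + d := by rw [hm, hd]; ring
  have eb : b = m - d := by rw [hm, hd]; ring
  have hm0 : 0 ≤ m := by rw [hm]; linarith
  clear hm hd
  subst ea eb
  have key : (1+c^2)*(1+3*m-2*m^2-2*d^2) + c*d*(3-4*m) ≤ 1+3*(c^2+m)-2*(c^2+m)^2 := by
    have s1 : c*d*(3-4*m) ≤ 2*d^2 + c^2*(3-4*m)^2/8 := by
      nlinarith [sq_nonneg (4*d - c*(3-4*m))]
    have s2 : 0 ≤ c^2 * (3 - 4*m - 2*c^2 - (1+3*m-2*m^2) - (3-4*m)^2/8) :=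
      mul_nonneg (sq_nonneg c) (by nlinarith [sq_nonneg c])
    nlinarith [mul_nonneg (sq_nonneg c) (sq_nonneg d)]
  have e3 : (m + d + (m - d))/2 = m := by ring
  rw [e3]
  nlinarith

lemma tile_ext {P Q : Tile M} (h1 : P.j = Q.j) (h2 : P.k = Q.k) : P = Q := by
  cases P; cases Q; simp_all

instance : Finite (Tile M) := by
  have : Function.Injective (fun P : Tile M =>
      ((⟨P.j, by
        refine ⟨P.hj, ?_⟩
        have h := P.hsub
        have h2 : (2:ℝ)^(-(M:ℤ)) ≤ 2 ^ P.k := zpow_le_zpow_right₀ (by norm_num) P.hk_lb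
        have hj : (0:ℝ) ≤ P.j := by exact_mod_cast P.hj
        have h3 : ((P.j:ℝ)+1) * 2^(-(M:ℤ)) ≤ 2^(M:ℤ) :=
          le_trans (mul_le_mul_of_nonneg_left h2 (by linarith)) h
        rw [zpow_neg, ← div_eq_mul_inv, div_le_iff₀ (by positivity)] at h3
        have h4 : ((P.j:ℝ)) ≤ ((2^M*2^M : ℤ) : ℝ) := by
          push_cast; rw [zpow_natCast] at h3; linarith
        exact_mod_cast h4⟩ : Set.Icc (0:ℤ) (2^M*2^M)),
       (⟨P.k, P.hk_lb, P.hk_ub⟩ : Set.Icc (-(M:ℤ)) M))) := by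
    intro P Q h
    simp only [Prod.mk.injEq] at h
    exact tile_ext (Subtype.mk.inj h.1) (Subtype.mk.inj h.2)
  exact Finite.of_injective _ this

lemma Tile.len_pos (P : Tile M) : 0 < P.len := by unfold Tile.len; positivity

def Tile.lc (P : Tile M) (h : -(M:ℤ) < P.k) : Tile M where
  j := 2 * P.j
  k := P.k - 1
  hk_lb := by omega
  hk_ub := by have := P.hk_ub; omega
  hj := by have := P.hj; omega
  hsub := by
    have := P.hsub
    have hp : (0:ℝ) < 2 ^ P.k := by positivity
    rw [zpow_sub_one₀ (by norm_num)]; push_cast; nlinarith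

def Tile.rc (P : Tile M) (h : -(M:ℤ) < P.k) : Tile M where
  j := 2 * P.j + 1
  k := P.k - 1
  hk_lb := by omega
  hk_ub := by have := P.hk_ub; omega
  hj := by have := P.hj; omega
  hsub := by
    have := P.hsub
    have hp : (0:ℝ) < 2 ^ P.k := by positivity
    rw [zpow_sub_one₀ (by norm_num)]; push_cast; nlinarith

lemma lc_ival (P : Tile M) (h) : (P.lc h).ival = P.left := by
  unfold Tile.ival Tile.left Tile.lc
  simp only [zpow_sub_one₀ (two_ne_zero' ℝ)]
  push_cast
  congr 1 <;> ring

lemma rc_ival (P : Tile M) (h) : (P.rc h).ival = P.right := by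
  unfold Tile.ival Tile.right Tile.rc
  simp only [zpow_sub_one₀ (two_ne_zero' ℝ)]
  push_cast
  congr 1 <;> ring

lemma lc_len (P : Tile M) (h) : (P.lc h).len = P.len / 2 := by
  unfold Tile.len Tile.lc
  simp only [zpow_sub_one₀ (two_ne_zero' ℝ)]
  ring

lemma rc_len (P : Tile M) (h) : (P.rc h).len = P.len / 2 := by
  unfold Tile.len Tile.rc
  simp only [zpow_sub_one₀ (two_ne_zero' ℝ)]
  ring

lemma lr_disj (P : Tile M) : Disjoint P.left P.right := by
  unfold Tile.left Tile.right
  exact Set.Ico_disjoint_Ico_same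

lemma lr_union (P : Tile M) : P.left ∪ P.right = P.ival := by
  unfold Tile.left Tile.right Tile.ival
  have hp : (0:ℝ) < 2 ^ P.k := by positivity
  apply Set.Ico_union_Ico_eq_Ico <;> nlinarith

lemma left_start (P : Tile M) : (P.j:ℝ) * 2^P.k ∈ P.left := by
  unfold Tile.left
  have hp : (0:ℝ) < 2 ^ P.k := by positivity
  constructor <;> nlinarith

lemma right_start (P : Tile M) : ((P.j:ℝ) + 1/2) * 2^P.k ∈ P.right := by
  unfold Tile.right
  have hp : (0:ℝ) < 2 ^ P.k := by positivity
  constructor <;> nlinarith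

lemma left_meas (P : Tile M) : MeasurableSet P.left := measurableSet_Ico
lemma right_meas (P : Tile M) : MeasurableSet P.right := measurableSet_Ico
lemma ival_meas (P : Tile M) : MeasurableSet P.ival := measurableSet_Ico

lemma ival_vol (P : Tile M) : volume P.ival = ENNReal.ofReal P.len := by
  unfold Tile.ival Tile.len
  rw [Real.volume_Ico]; congr 1; ring

/-- sum of squares below `P` -/
def sqSum (f : ℝ → ℝ) (P : Tile M) : ℝ := ∑ᶠ Q ∈ cTree P, waveCoeff f Q ^ 2

lemma sqSum_nonneg (f : ℝ → ℝ) (P : Tile M) : 0 ≤ sqSum f P := by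
  unfold sqSum
  exact finsum_nonneg fun Q => finsum_nonneg fun _ => sq_nonneg _

lemma start_mem (Q : Tile M) : (Q.j:ℝ) * 2^Q.k ∈ Q.ival := by
  rw [← lr_union]; exact Or.inl (left_start Q)

lemma sqSum_rec (f : ℝ → ℝ) (P : Tile M) (h : -(M:ℤ) < P.k) :
    waveCoeff f P ^ 2 + (sqSum f (P.lc h) + sqSum f (P.rc h)) ≤ sqSum f P := by
  have d1 : Disjoint (cTree (P.lc h)) (cTree (P.rc h)) := by
    rw [Set.disjoint_left]
    intro Q h1 h2
    have h1' := h1 (start_mem Q)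
    have h2' := h2 (start_mem Q)
    rw [lc_ival] at h1'; rw [rc_ival] at h2'
    exact Set.disjoint_left.1 (lr_disj P) h1' h2'
  have d2 : Disjoint {P} (cTree (P.lc h) ∪ cTree (P.rc h)) := by
    rw [Set.disjoint_singleton_left]
    rintro (h1 | h1)
    · have : P.ival ⊆ P.left := by rw [← lc_ival P h]; exact h1
      have h3 := this (by rw [← lr_union]; exact Or.inr (right_start P))
      exact Set.disjoint_left.1 (lr_disj P) h3 (right_start P)
    · have : P.ival ⊆ P.right := by rw [← rc_ival P h]; exact h1
      have h3 := this (by rw [← lr_union]; exact Or.inl (left_start P))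
      exact Set.disjoint_left.1 (lr_disj P) (left_start P) h3
  have hsub : {P} ∪ (cTree (P.lc h) ∪ cTree (P.rc h)) ⊆ cTree P := by
    rintro Q (h1 | h1 | h1)
    · rw [Set.mem_singleton_iff.1 h1]; exact Set.Subset.refl P.ival
    · refine Set.Subset.trans h1 ?_
      rw [lc_ival, ← lr_union]; exact Set.subset_union_left
    · refine Set.Subset.trans h1 ?_
      rw [rc_ival, ← lr_union]; exact Set.subset_union_right
  unfold sqSum
  rw [← finsum_mem_union d1 (Set.toFinite _) (Set.toFinite _),
    ← finsum_mem_singleton (f := fun Q => waveCoeff f Q ^ 2) (a := P),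
    ← finsum_mem_union d2 (Set.toFinite _) (Set.toFinite _)]
  rw [finsum_mem_eq_finite_toFinset_sum _ (Set.toFinite _),
    finsum_mem_eq_finite_toFinset_sum _ (Set.toFinite _)]
  apply Finset.sum_le_sum_of_subset_of_nonneg
  · intro Q hQ
    simp only [Set.Finite.mem_toFinset] at hQ ⊢
    exact hsub hQ
  · intros; positivity

lemma bmo_sq (f : ℝ → ℝ) (P : Tile M) : sqSum f P ≤ bmoNorm M f ^ 2 * P.len := by
  have hb : BddAbove (insert 0 {s : ℝ | ∃ T : Tree M, T.tiles ⊆ univ ∧ IsConvex T.tiles ∧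
      s = treeSize (fun P : Tile M => waveCoeff f P ^ 2) T}) := by
    apply Set.Finite.bddAbove
    apply Set.Finite.insert
    apply (Set.finite_range (fun q : Set (Tile M) × Tile M =>
      (∑ᶠ P ∈ q.1, waveCoeff f P ^ 2) / q.2.len)).subset
    rintro s ⟨T, -, -, rfl⟩
    exact ⟨(T.tiles, T.top), rfl⟩
  have h0 : 0 ≤ maxSize (fun P : Tile M => waveCoeff f P ^ 2) univ :=
    le_csSup hb (Set.mem_insert _ _)
  have h1 : sqSum f P / P.len ≤ maxSize (fun P : Tile M => waveCoeff f P ^ 2) univ := by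
    apply le_csSup hb
    right
    refine ⟨⟨cTree P, P, Set.Subset.refl P.ival, fun _ h => h⟩, Set.subset_univ _, ?_, rfl⟩
    intro P₁ _ P₂ h2 Q _ hQ
    exact Set.Subset.trans hQ h2
  unfold bmoNorm
  rw [Real.sq_sqrt h0]
  rwa [div_le_iff₀ P.len_pos] at h1

lemma test_eq {f : ℝ → ℝ} (hf : IsTestFun M f) (x : ℝ) :
    f x = f ((⌊x * 2^(M:ℤ)⌋ : ℝ) * 2^(-(M:ℤ))) := by
  have hp : (0:ℝ) < 2 ^ (M:ℤ) := by positivity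
  have h1 := Int.floor_le (x * 2^(M:ℤ))
  have h2 := Int.lt_floor_add_one (x * 2^(M:ℤ))
  apply hf.2 ⌊x * 2^(M:ℤ)⌋
  · unfold gridIval
    rw [zpow_neg, ← div_eq_mul_inv, ← div_eq_mul_inv]
    exact ⟨by rwa [div_le_iff₀ hp], by rwa [lt_div_iff₀ hp]⟩
  · unfold gridIval
    have : (0:ℝ) < 2 ^ (-(M:ℤ)) := by positivity
    constructor <;> nlinarith

lemma test_meas {f : ℝ → ℝ} (hf : IsTestFun M f) : Measurable f := by
  have : f = (fun j : ℤ => f ((j:ℝ) * 2^(-(M:ℤ)))) ∘ (fun x : ℝ => ⌊x * 2^(M:ℤ)⌋) := by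
    funext x; exact test_eq hf x
  rw [this]
  exact (measurable_of_countable _).comp (Int.measurable_floor.comp (measurable_id.mul_const _))

lemma test_bdd {f : ℝ → ℝ} (hf : IsTestFun M f) : ∃ K, ∀ x, |f x| ≤ K := by
  have hfin : (Set.range f).Finite := by
    have : Set.range f ⊆ insert 0 ((fun j : ℤ => f ((j:ℝ) * 2^(-(M:ℤ)))) ''
        (Set.Icc (0:ℤ) (2^M*2^M))) := by
      rintro _ ⟨x, rfl⟩
      by_cases hx : x ∈ Ico (0 : ℝ) (2 ^ (M : ℤ))
      · right
        refine ⟨⌊x * 2^(M:ℤ)⌋, ⟨?_, ?_⟩, (test_eq hf x).symm⟩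
        · apply Int.floor_nonneg.2; exact mul_nonneg hx.1 (by positivity)
        · have h1 := Int.floor_le (x * 2^(M:ℤ))
          have : ((⌊x * 2^(M:ℤ)⌋ : ℤ) : ℝ) ≤ ((2^M*2^M : ℤ) : ℝ) := by
            push_cast
            rw [← zpow_natCast]
            exact h1.trans (mul_le_mul_of_nonneg_right hx.2.le (by positivity))
          exact_mod_cast this
      · left; exact hf.1 x hx
    exact (((Set.finite_Icc _ _).image _).insert _).subset this
  obtain ⟨K, hK⟩ := (hfin.image (fun y => |y|)).bddAbove
  exact ⟨K, fun x => hK ⟨f x, ⟨x, rfl⟩, rfl⟩⟩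

lemma int_on {g : ℝ → ℝ} (hg : Measurable g) (K : ℝ) (hK : ∀ x, |g x| ≤ K) (P : Tile M) :
    IntegrableOn g P.ival := by
  apply Measure.integrableOn_of_bounded (M := K)
  · rw [ival_vol]; exact ENNReal.ofReal_ne_top
  · exact hg.aestronglyMeasurable
  · exact Filter.Eventually.of_forall fun x => hK x

lemma exp_bdd {f : ℝ → ℝ} (hf : IsTestFun M f) (s a : ℝ) :
    ∃ K, ∀ x, |Real.exp (s * (f x - a))| ≤ K := by
  obtain ⟨K, hK⟩ := test_bdd hf
  refine ⟨Real.exp (|s| * (K + |a|)), fun x => ?_⟩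
  rw [abs_of_pos (Real.exp_pos _)]
  apply Real.exp_le_exp.2
  calc s * (f x - a) ≤ |s * (f x - a)| := le_abs_self _
    _ = |s| * |f x - a| := abs_mul _ _
    _ ≤ _ := mul_le_mul_of_nonneg_left ((abs_sub _ _).trans (by linarith [hK x])) (abs_nonneg _)

lemma exp_int {f : ℝ → ℝ} (hf : IsTestFun M f) (s a : ℝ) (P : Tile M) :
    IntegrableOn (fun x => Real.exp (s * (f x - a))) P.ival := by
  obtain ⟨K, hK⟩ := exp_bdd hf s a
  exact int_on (by have := test_meas hf; fun_prop) K hK P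

lemma wave_eq {f : ℝ → ℝ} (hf : IsTestFun M f) (P : Tile M) (h : -(M:ℤ) < P.k) :
    waveCoeff f P ^ 2 = P.len * ((tileAvg f (P.lc h) - tileAvg f (P.rc h))/2)^2 := by
  obtain ⟨K, hK⟩ := test_bdd hf
  have il := int_on (test_meas hf) K hK (P.lc h)
  have ir := int_on (test_meas hf) K hK (P.rc h)
  have hW : waveCoeff f P = (Real.sqrt P.len)⁻¹ *
      ((∫ x in (P.lc h).ival, f x) - ∫ x in (P.rc h).ival, f x) := by
    unfold waveCoeff
    rw [← integral_indicator (ival_meas _), ← integral_indicator (ival_meas _),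
      ← integral_sub (il.integrable_indicator (ival_meas _))
        (ir.integrable_indicator (ival_meas _)), ← integral_const_mul]
    congr 1
    funext x
    unfold Tile.haar
    rw [lc_ival, rc_ival]
    by_cases h1 : x ∈ P.left <;> by_cases h2 : x ∈ P.right <;> simp [h1, h2] <;> ring
  have hl := P.len_pos
  rw [hW]
  unfold tileAvg
  rw [lc_len, rc_len, mul_pow, inv_pow, Real.sq_sqrt hl.le]
  field_simp

lemma avg_eq {f : ℝ → ℝ} (hf : IsTestFun M f) (P : Tile M) (h : -(M:ℤ) < P.k) :
    tileAvg f P = (tileAvg f (P.lc h) + tileAvg f (P.rc h))/2 := by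
  obtain ⟨K, hK⟩ := test_bdd hf
  have il := int_on (test_meas hf) K hK (P.lc h)
  have ir := int_on (test_meas hf) K hK (P.rc h)
  have hl := P.len_pos
  unfold tileAvg
  rw [lc_len, rc_len]
  rw [lc_ival] at il ⊢
  rw [rc_ival] at ir ⊢
  rw [← lr_union, setIntegral_union (lr_disj P) (right_meas P) il ir]
  field_simp

lemma main_ind {f : ℝ → ℝ} (hf : IsTestFun M f) (s : ℝ)
    (hs : ∀ P : Tile M, s^2 * (sqSum f P / P.len) ≤ 1/8) (n : ℕ) :
    ∀ P : Tile M, P.k = -(M:ℤ) + n →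
      ∫ x in P.ival, Real.exp (s * (f x - tileAvg f P)) ≤
        P.len * (1 + 3 * (s^2 * (sqSum f P / P.len)) - 2 * (s^2 * (sqSum f P / P.len))^2) := by
  induction n with
  | zero =>
    intro P hk
    have hl := P.len_pos
    have hv : 0 ≤ s^2 * (sqSum f P / P.len) :=
      mul_nonneg (sq_nonneg _) (div_nonneg (sqSum_nonneg f P) hl.le)
    have hv2 := hs P
    have hk' : P.k = -(M:ℤ) := by simpa using hk
    have hg : P.ival = gridIval M P.j := by unfold Tile.ival gridIval; rw [hk']
    have hc : ∀ x ∈ P.ival, f x = f ((P.j:ℝ) * 2^P.k) := by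
      intro x hx
      have h2 := start_mem P
      rw [hg] at hx h2
      exact hf.2 _ _ hx _ h2
    have hvol : volume.real P.ival = P.len := by
      rw [Measure.real, ival_vol, ENNReal.toReal_ofReal hl.le]
    have ha : tileAvg f P = f ((P.j:ℝ) * 2^P.k) := by
      unfold tileAvg
      rw [setIntegral_congr_fun (ival_meas P) hc, setIntegral_const, hvol, smul_eq_mul]
      field_simp
    have h1 : ∫ x in P.ival, Real.exp (s * (f x - tileAvg f P)) = P.len := by
      rw [setIntegral_congr_fun (g := fun _ => (1:ℝ)) (ival_meas P), setIntegral_const, hvol]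
      · simp
      · intro x hx
        simp [hc x hx, ha]
    rw [h1]
    have : 1 ≤ 1 + 3 * (s^2 * (sqSum f P / P.len)) - 2 * (s^2 * (sqSum f P / P.len))^2 := by
      nlinarith
    nlinarith
  | succ n ih =>
    intro P hk
    push_cast at hk
    have h : -(M:ℤ) < P.k := by omega
    have hl := P.len_pos
    have i1 := ih (P.lc h) (by show P.k - 1 = _; omega)
    have i2 := ih (P.rc h) (by show P.k - 1 = _; omega)
    have hA := avg_eq hf P h
    have hW := wave_eq hf P h
    have hS := sqSum_rec f P h
    have nl := sqSum_nonneg f (P.lc h)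
    have nr := sqSum_nonneg f (P.rc h)
    have hvP := hs P
    have eil := exp_int hf s (tileAvg f P) (P.lc h)
    have eir := exp_int hf s (tileAvg f P) (P.rc h)
    set A := tileAvg f (P.lc h) with hAdef
    set D := tileAvg f (P.rc h) with hDdef
    have j1 : ∫ x in (P.lc h).ival, Real.exp (s * (f x - tileAvg f P)) =
        Real.exp (s * ((A - D)/2)) * ∫ x in (P.lc h).ival, Real.exp (s * (f x - A)) := by
      rw [← integral_const_mul]
      congr 1; funext x
      rw [← Real.exp_add, hA]; congr 1; ring
    have j2 : ∫ x in (P.rc h).ival, Real.exp (s * (f x - tileAvg f P)) =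
        Real.exp (-(s * ((A - D)/2))) * ∫ x in (P.rc h).ival, Real.exp (s * (f x - D)) := by
      rw [← integral_const_mul]
      congr 1; funext x
      rw [← Real.exp_add, hA]; congr 1; ring
    have j3 : ∫ x in P.ival, Real.exp (s * (f x - tileAvg f P)) =
        (∫ x in (P.lc h).ival, Real.exp (s * (f x - tileAvg f P))) +
        ∫ x in (P.rc h).ival, Real.exp (s * (f x - tileAvg f P)) := by
      rw [lc_ival] at eil ⊢
      rw [rc_ival] at eir ⊢
      rw [← lr_union, setIntegral_union (lr_disj P) (right_meas P) eil eir]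
    rw [j3, j1, j2]
    rw [lc_len] at i1
    rw [rc_len] at i2
    set a := s^2 * (sqSum f (P.lc h) / (P.len/2)) with ha
    set b := s^2 * (sqSum f (P.rc h) / (P.len/2)) with hb
    set v := s^2 * (sqSum f P / P.len) with hv
    have hcab : (s * ((A - D)/2))^2 + (a+b)/2 ≤ v := by
      have e : (s * ((A - D)/2))^2 + (a+b)/2 = s^2 * ((waveCoeff f P ^ 2 +
          (sqSum f (P.lc h) + sqSum f (P.rc h))) / P.len) := by
        rw [hW, ha, hb]; field_simp
      rw [e, hv]
      gcongr
    have B := bell_ineq (s * ((A - D)/2)) a b v (by positivity) (by positivity) hvP hcab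
    have t1 := mul_le_mul_of_nonneg_left i1 (Real.exp_pos (s * ((A - D)/2))).le
    have t2 := mul_le_mul_of_nonneg_left i2 (Real.exp_pos (-(s * ((A - D)/2)))).le
    have t3 := mul_le_mul_of_nonneg_left B hl.le
    linarith

lemma exp_main {f : ℝ → ℝ} (hf : IsTestFun M f) (I : Tile M) (h0 : ∫ x, f x = 0)
    (hI : ∀ x ∉ I.ival, f x = 0) (B s : ℝ) (hB : bmoNorm M f ≤ B)
    (hs : s^2 * B^2 ≤ 1/8) :
    ∫ x in I.ival, Real.exp (s * f x) ≤ I.len * 2 := by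
  have hn : 0 ≤ bmoNorm M f := Real.sqrt_nonneg _
  have hs' : ∀ P : Tile M, s^2 * (sqSum f P / P.len) ≤ 1/8 := by
    intro P
    refine le_trans ?_ hs
    apply mul_le_mul_of_nonneg_left _ (sq_nonneg s)
    rw [div_le_iff₀ P.len_pos]
    refine (bmo_sq f P).trans ?_
    apply mul_le_mul_of_nonneg_right _ P.len_pos.le
    nlinarith
  have hlb := I.hk_lb
  have := main_ind hf s hs' (I.k + M).toNat I (by omega)
  have ha : tileAvg f I = 0 := by
    unfold tileAvg
    rw [setIntegral_eq_integral_of_forall_compl_eq_zero hI, h0, zero_div]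
  rw [ha] at this
  simp only [sub_zero] at this
  refine this.trans (mul_le_mul_of_nonneg_left ?_ I.len_pos.le)
  have := hs' I
  nlinarith [sq_nonneg (s^2 * (sqSum f I / I.len))]

lemma pw_bound (p : ℝ) (hp : 0 < p) :
    ∃ α β : ℝ, 0 ≤ α ∧ 0 ≤ β ∧ α + 4 * β ≤ (Real.exp 16 * (1+p))^p ∧
      ∀ x : ℝ, 0 ≤ x → x^p ≤ α + β * Real.exp (x/4) := by
  have h16 : (16:ℝ) ≤ Real.exp 16 := by linarith [Real.add_one_le_exp (16:ℝ)]
  by_cases h1 : p ≤ 1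
  · refine ⟨1, 4*p, by norm_num, by positivity, ?_, ?_⟩
    · calc 1 + 4*(4*p) ≤ Real.exp (16*p) := by linarith [Real.add_one_le_exp (16*p)]
        _ = (Real.exp 16)^p := by rw [Real.exp_mul]
        _ ≤ _ := by
          apply Real.rpow_le_rpow (Real.exp_pos _).le _ hp.le
          nlinarith [Real.exp_pos (16:ℝ)]
    · intro x hx
      have h2 := rpow_one_add_le_one_add_mul_self (s := x - 1) (by linarith) hp.le h1
      rw [show 1 + (x-1) = x by ring] at h2
      have h3 := Real.add_one_le_exp (x/4)
      nlinarith [mul_le_mul_of_nonneg_left h3 hp.le]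
  · push Not at h1
    refine ⟨0, (4*p)^p, le_refl _, by positivity, ?_, ?_⟩
    · have h4 : (4:ℝ) ≤ 4^p := by
        calc (4:ℝ) = 4^(1:ℝ) := by simp
          _ ≤ 4^p := Real.rpow_le_rpow_of_exponent_le (by norm_num) h1.le
      calc 0 + 4 * (4*p)^p ≤ 4^p * (4*p)^p := by
            have : 0 ≤ (4*p)^p := by positivity
            nlinarith
        _ = (4*(4*p))^p := (Real.mul_rpow (by norm_num) (by positivity)).symm
        _ ≤ _ := by
          apply Real.rpow_le_rpow (by positivity) _ hp.le
          nlinarith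
    · intro x hx
      have h3 := Real.add_one_le_exp (x/(4*p))
      have h5 : x ≤ 4*p * Real.exp (x/(4*p)) := by
        have : x = 4*p*(x/(4*p)) := by field_simp
        calc x = 4*p*(x/(4*p)) := this
          _ ≤ _ := mul_le_mul_of_nonneg_left (by linarith) (by positivity)
      calc x^p ≤ (4*p * Real.exp (x/(4*p)))^p := Real.rpow_le_rpow hx h5 hp.le
        _ = (4*p)^p * Real.exp (x/4) := by
          rw [Real.mul_rpow (by positivity) (Real.exp_pos _).le, ← Real.exp_mul]
          congr 2; field_simp
        _ = _ := by ring

lemma lp_main {f : ℝ → ℝ} (hf : IsTestFun M f) (I : Tile M) (h0 : ∫ x, f x = 0)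
    (hI : ∀ x ∉ I.ival, f x = 0) (B : ℝ) (hB : bmoNorm M f ≤ B) (hB0 : 0 < B)
    (p : ℝ) (hp : 0 < p) :
    (∫ x, |f x| ^ p) ^ (1 / p) ≤ Real.exp 16 * (1 + p) * I.len ^ (1 / p) * B := by
  obtain ⟨α, β, hα, hβ, hab, hx⟩ := pw_bound p hp
  have hl := I.len_pos
  have s1 : ∀ ε : ℝ, ε^2 = 1 → (ε/(4*B))^2 * B^2 ≤ 1/8 := by
    intro ε he
    rw [div_pow, he]; field_simp; norm_num
  have e1 := exp_main hf I h0 hI B (1/(4*B)) hB (s1 1 (by norm_num))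
  have e2 := exp_main hf I h0 hI B (-1/(4*B)) hB (s1 (-1) (by norm_num))
  have i1 := exp_int hf (1/(4*B)) 0 I
  have i2 := exp_int hf (-1/(4*B)) 0 I
  simp only [sub_zero] at i1 i2
  have hfm := test_meas hf
  obtain ⟨K, hK⟩ := test_bdd hf
  have ip : IntegrableOn (fun x => |f x| ^ p) I.ival := by
    apply int_on (by fun_prop) (K^p)
    intro x
    rw [abs_of_nonneg (by positivity)]
    exact Real.rpow_le_rpow (abs_nonneg _) (hK x) hp.le
  have hBp : 0 < B^p := by positivity
  have ic : IntegrableOn (fun _ : ℝ => α) I.ival :=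
    int_on measurable_const |α| (fun _ => le_refl _) I
  have pt : ∀ x ∈ I.ival, |f x|^p ≤ B^p * (α + β * (Real.exp (1/(4*B) * f x) +
      Real.exp (-1/(4*B) * f x))) := by
    intro x _
    have h1 := hx (|f x|/B) (by positivity)
    have h2 : |f x|^p = B^p * (|f x|/B)^p := by
      rw [← Real.mul_rpow hB0.le (by positivity)]; congr 1; field_simp
    rw [h2]
    refine mul_le_mul_of_nonneg_left (h1.trans ?_) hBp.le
    have h3 : Real.exp (|f x|/B/4) ≤ Real.exp (1/(4*B) * f x) + Real.exp (-1/(4*B) * f x) := by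
      rcases abs_cases (f x) with ⟨h, _⟩ | ⟨h, _⟩
      · have : |f x|/B/4 = 1/(4*B) * f x := by rw [h]; field_simp
        rw [this]; linarith [Real.exp_pos (-1/(4*B) * f x)]
      · have : |f x|/B/4 = -1/(4*B) * f x := by rw [h]; field_simp
        rw [this]; linarith [Real.exp_pos (1/(4*B) * f x)]
    have := mul_le_mul_of_nonneg_left h3 hβ
    linarith
  have hvol : volume.real I.ival = I.len := by
    rw [Measure.real, ival_vol, ENNReal.toReal_ofReal hl.le]
  have isum := (i1.add i2).const_mul β
  have hmain : ∫ x, |f x|^p ≤ B^p * (I.len * (Real.exp 16 * (1+p))^p) := by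
    have hz : ∀ x ∉ I.ival, |f x|^p = 0 := by
      intro x hx; rw [hI x hx, abs_zero, Real.zero_rpow hp.ne']
    rw [← setIntegral_eq_integral_of_forall_compl_eq_zero hz]
    refine (setIntegral_mono_on ip ((ic.add isum).const_mul (B^p)) (ival_meas I) pt).trans ?_
    rw [integral_const_mul]
    apply mul_le_mul_of_nonneg_left _ hBp.le
    have e3 := integral_add ic isum
    have e4 := integral_add i1 i2
    simp only [Pi.add_apply] at e3 e4 ⊢
    rw [e3, integral_const_mul, e4, setIntegral_const, hvol, smul_eq_mul]
    nlinarith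
  have hD : 0 < Real.exp 16 * (1+p) := by positivity
  calc (∫ x, |f x| ^ p) ^ (1 / p) ≤ (B^p * (I.len * (Real.exp 16 * (1+p))^p))^(1/p) := by
        apply Real.rpow_le_rpow _ hmain (by positivity)
        exact integral_nonneg fun x => by positivity
    _ = _ := by
      rw [Real.mul_rpow (by positivity) (by positivity),
        Real.mul_rpow hl.le (by positivity), ← Real.rpow_mul hB0.le, ← Real.rpow_mul hD.le,
        mul_one_div_cancel hp.ne', Real.rpow_one, Real.rpow_one]
      ring

lemma lp_main' {f : ℝ → ℝ} (hf : IsTestFun M f) (I : Tile M) (h0 : ∫ x, f x = 0)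
    (hI : ∀ x ∉ I.ival, f x = 0) (p : ℝ) (hp : 0 < p) :
    (∫ x, |f x| ^ p) ^ (1 / p) ≤ Real.exp 16 * (1 + p) * I.len ^ (1 / p) * bmoNorm M f := by
  have hn : 0 ≤ bmoNorm M f := Real.sqrt_nonneg _
  have hl := I.len_pos
  set D := Real.exp 16 * (1 + p) * I.len ^ (1 / p) with hD
  have hD0 : 0 < D := by positivity
  apply le_of_forall_pos_le_add
  intro ε hε
  have := lp_main hf I h0 hI (bmoNorm M f + ε / D) (by have := div_pos hε hD0; linarith)
    (by positivity) p hp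
  rw [← hD] at this
  refine this.trans (le_of_eq ?_)
  field_simp

lemma vol_main {f : ℝ → ℝ} (hf : IsTestFun M f) (I : Tile M) (h0 : ∫ x, f x = 0)
    (hI : ∀ x ∉ I.ival, f x = 0) (n : ℕ) :
    volume {x : ℝ | x ∈ I.ival ∧ 2 * (n : ℝ) * bmoNorm M f < f x}
      ≤ ENNReal.ofReal ((2 : ℝ) ^ (1 - (n : ℤ)) * I.len) := by
  have hn : 0 ≤ bmoNorm M f := Real.sqrt_nonneg _
  have hfm := test_meas hf
  have hl := I.len_pos
  rcases hn.eq_or_lt with hB | hB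
  · have h1 := lp_main' hf I h0 hI 1 one_pos
    rw [← hB, mul_zero] at h1
    simp only [Real.rpow_one, div_one] at h1
    obtain ⟨K, hK⟩ := test_bdd hf
    have hint : Integrable f := by
      have := (int_on hfm K hK I).integrable_indicator (ival_meas I)
      rwa [Set.indicator_eq_self.2] at this
      intro x hx
      by_contra h
      exact hx (hI x h)
    have h2 : ∫ x, |f x| = 0 := le_antisymm h1 (integral_nonneg fun x => abs_nonneg _)
    rw [integral_eq_zero_iff_of_nonneg (fun x => abs_nonneg _) hint.abs] at h2
    have h3 : volume {x : ℝ | x ∈ I.ival ∧ 2 * (n : ℝ) * 0 < f x} = 0 := by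
      refine measure_mono_null ?_ (ae_iff.1 h2)
      rintro x ⟨_, hx⟩
      simp only [mul_zero] at hx
      simp [hx.ne']
    rw [← hB, h3]
    exact bot_le
  · set B := bmoNorm M f with hBdef
    set t := Real.log 2 / 2 with ht
    have hlog := Real.log_two_lt_d9
    have hlog0 := Real.log_two_gt_d9
    have ht0 : 0 < t := by rw [ht]; linarith
    have e1 := exp_main hf I h0 hI B (t/B) le_rfl (by
      rw [div_pow, div_mul_cancel₀ _ (by positivity), ht]; nlinarith)
    have i1 := exp_int hf (t/B) 0 I
    simp only [sub_zero] at i1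
    have mk := mul_meas_ge_le_integral_of_nonneg (μ := volume.restrict I.ival)
      (Filter.Eventually.of_forall fun x => (Real.exp_pos (t/B * f x)).le) i1 (2^n)
    have hms : MeasurableSet {x | (2:ℝ)^n ≤ Real.exp (t/B * f x)} :=
      measurableSet_le measurable_const (by fun_prop)
    rw [Measure.real, Measure.restrict_apply hms] at mk
    have hsub : {x : ℝ | x ∈ I.ival ∧ 2 * (n : ℝ) * B < f x} ⊆
        {x | (2:ℝ)^n ≤ Real.exp (t/B * f x)} ∩ I.ival := by
      rintro x ⟨hx, hlt⟩
      refine ⟨?_, hx⟩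
      show (2:ℝ)^n ≤ _
      calc (2:ℝ)^n = Real.exp (n * Real.log 2) := by
            rw [Real.exp_nat_mul, Real.exp_log two_pos]
        _ = Real.exp (t/B * (2*n*B)) := by rw [ht]; congr 1; field_simp
        _ ≤ _ := Real.exp_le_exp.2 (mul_le_mul_of_nonneg_left hlt.le (by positivity))
    refine (measure_mono hsub).trans ?_
    have hfin : volume ({x | (2:ℝ)^n ≤ Real.exp (t/B * f x)} ∩ I.ival) ≠ ⊤ :=
      measure_ne_top_of_subset Set.inter_subset_right (by rw [ival_vol]; exact ENNReal.ofReal_ne_top)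
    rw [← ENNReal.ofReal_toReal hfin]
    apply ENNReal.ofReal_le_ofReal
    rw [zpow_sub₀ two_ne_zero, zpow_one, zpow_natCast, div_mul_eq_mul_div,
      le_div_iff₀ (by positivity)]
    linarith

/-- John–Nirenberg inequality, dyadic form. -/
theorem statement2 :
    ∃ C : ℝ, 0 < C ∧
      ∀ (M : ℕ) (I : Tile M) (f : ℝ → ℝ),
        IsTestFun M f → (∫ x, f x) = 0 → (∀ x ∉ I.ival, f x = 0) →
        (∀ p : ℝ, 0 < p →
          (∫ x, |f x| ^ p) ^ (1 / p) ≤ C * (1 + p) * I.len ^ (1 / p) * bmoNorm M f) ∧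
        (∀ n : ℕ, 0 < n →
          volume {x : ℝ | x ∈ I.ival ∧ 2 * (n : ℝ) * bmoNorm M f < f x}
            ≤ ENNReal.ofReal ((2 : ℝ) ^ (1 - (n : ℤ)) * I.len)) := by
  refine ⟨Real.exp 16, Real.exp_pos _, fun M I f hf h0 hI => ⟨fun p hp => ?_, fun n _ => ?_⟩⟩
  · exact lp_main' hf I h0 hI p hp
  · exact vol_main hf I h0 hI n

end Dyadic
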